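/- For a strictly polytopic system with input matrix B, the following are equivalent: (a) there exist matrices K̄_i ∈ ℝ^{n_u×n_x} (i = 1,…,N) such that the feedback gain K(k,p) := Σ_{i=1}^N ξ_i(p_k)K̄_i renders the closed-loop system x_{k+1} = (A(p_k) + BK(k,p))x_k poly-quadratically stable; (b) there exist symmetric positive definite matrices S̄_i ∈ ℝ^{n_x×n_x} and matrices Y_i ∈ ℝ^{n_u×n_x} (i = 1,…,N) such that the 2×2 block matrix [[S̄_i, (A_iS̄_i + BY_i)ᵀ],[A_iS̄_i + BY_i, S̄_j]] is positive definite for all i, j ∈ {1,…,N}. -/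

import Mathlib

open Matrix

/-- A feedback gain `K(k,p)` renders the closed-loop system
`x_{k+1} = (A(p_k) + BK(k,p))x_k` poly-quadratically stable with poly-quadratic
Lyapunov function `V(π,x) = xᵀP(π)x`, `P(π) = Σᵢ ξᵢ(π)P̄ᵢ`. -/
def RendersClosedLoopPolyQS (nx nu np N : ℕ) (Pset : Set (Fin np → ℝ))
    (ξ : Fin N → Pset → ℝ) (A : Fin N → Matrix (Fin nx) (Fin nx) ℝ)
    (B : Matrix (Fin nx) (Fin nu) ℝ)
    (K : ℕ → (ℕ → Pset) → Matrix (Fin nu) (Fin nx) ℝ)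
    (Pb : Fin N → Matrix (Fin nx) (Fin nx) ℝ) : Prop :=
  ∃ a₁ a₂ a₃ : ℝ, 0 < a₁ ∧ 0 < a₂ ∧ 0 < a₃ ∧
    (∀ (π : Pset) (x : Fin nx → ℝ),
      a₁ * (x ⬝ᵥ x) ≤ x ⬝ᵥ ((∑ i, ξ i π • Pb i) *ᵥ x) ∧
      x ⬝ᵥ ((∑ i, ξ i π • Pb i) *ᵥ x) ≤ a₂ * (x ⬝ᵥ x)) ∧
    (∀ (p : ℕ → Pset) (k : ℕ) (x : Fin nx → ℝ),
      (((∑ i, ξ i (p k) • A i) + B * K k p) *ᵥ x) ⬝ᵥ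
          ((∑ i, ξ i (p (k + 1)) • Pb i) *ᵥ
            (((∑ i, ξ i (p k) • A i) + B * K k p) *ᵥ x))
        ≤ x ⬝ᵥ ((∑ i, ξ i (p k) • Pb i) *ᵥ x) - a₃ * (x ⬝ᵥ x))

section QuadraticForm

variable {n : Type*} [Fintype n]

lemma dotProduct_mulVec_comm_of_isSymm {Q : Matrix n n ℝ} (hQ : Q.IsSymm) (x y : n → ℝ) :
    x ⬝ᵥ (Q *ᵥ y) = y ⬝ᵥ (Q *ᵥ x) := by
  rw [dotProduct_mulVec, ← mulVec_transpose, hQ.eq, dotProduct_comm]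

lemma dotProduct_sum_smul_mulVec {ι : Type*} [Fintype ι] (w : ι → ℝ) (Q : ι → Matrix n n ℝ)
    (x y : n → ℝ) :
    x ⬝ᵥ ((∑ i, w i • Q i) *ᵥ y) = ∑ i, w i * (x ⬝ᵥ (Q i *ᵥ y)) := by
  simp only [sum_mulVec, dotProduct_sum, smul_mulVec, dotProduct_smul, smul_eq_mul]

lemma exists_dotProduct_mulVec_le (Q : Matrix n n ℝ) :
    ∃ C : ℝ, 0 < C ∧ ∀ x : n → ℝ, x ⬝ᵥ (Q *ᵥ x) ≤ C * (x ⬝ᵥ x) := by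
  refine ⟨∑ i, ∑ j, |Q i j| + 1, by positivity, fun x => ?_⟩
  have hx : ∀ i, x i * x i ≤ x ⬝ᵥ x := fun i =>
    Finset.single_le_sum (f := fun i => x i * x i) (fun i _ => mul_self_nonneg _)
      (Finset.mem_univ i)
  have hxx : 0 ≤ x ⬝ᵥ x := Finset.sum_nonneg fun i _ => mul_self_nonneg _
  have h : x ⬝ᵥ (Q *ᵥ x) ≤ (∑ i, ∑ j, |Q i j|) * (x ⬝ᵥ x) := by
    have hexpand : x ⬝ᵥ (Q *ᵥ x) = ∑ i, ∑ j, x i * (Q i j * x j) := by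
      simp only [mulVec, dotProduct, Finset.mul_sum]
    rw [hexpand]
    simp only [Finset.sum_mul]
    refine Finset.sum_le_sum fun i _ => Finset.sum_le_sum fun j _ => ?_
    have hij : |x i * x j| ≤ x ⬝ᵥ x := by
      rw [abs_le]
      constructor <;>
        nlinarith [hx i, hx j, sq_nonneg (x i + x j), sq_nonneg (x i - x j)]
    calc x i * (Q i j * x j) ≤ |x i * (Q i j * x j)| := le_abs_self _
      _ = |Q i j| * |x i * x j| := by rw [← abs_mul]; congr 1; ring
      _ ≤ |Q i j| * (x ⬝ᵥ x) := by gcongr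
  linarith

lemma Matrix.PosDef.exists_le_dotProduct_mulVec [DecidableEq n] {Q : Matrix n n ℝ}
    (hQ : Q.PosDef) :
    ∃ c : ℝ, 0 < c ∧ ∀ x : n → ℝ, c * (x ⬝ᵥ x) ≤ x ⬝ᵥ (Q *ᵥ x) := by
  obtain ⟨C, hC, hCx⟩ := exists_dotProduct_mulVec_le Q⁻¹
  refine ⟨C⁻¹, by positivity, fun x => ?_⟩
  have hdet : IsUnit Q.det := (isUnit_iff_isUnit_det Q).1 hQ.isUnit
  have hsymm : Q.IsSymm := hQ.isHermitian
  have hnonneg := hQ.posSemidef.dotProduct_mulVec_nonneg (x - C⁻¹ • (Q⁻¹ *ᵥ x))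
  have hQx : Q *ᵥ (Q⁻¹ *ᵥ x) = x := by
    rw [mulVec_mulVec, mul_nonsing_inv _ hdet, one_mulVec]
  have hcross : (Q⁻¹ *ᵥ x) ⬝ᵥ (Q *ᵥ x) = x ⬝ᵥ x := by
    rw [dotProduct_mulVec_comm_of_isSymm hsymm, hQx]
  simp only [star_trivial, mulVec_sub, mulVec_smul, sub_dotProduct, dotProduct_sub,
    smul_dotProduct, dotProduct_smul, smul_eq_mul, hQx, hcross,
    dotProduct_comm (Q⁻¹ *ᵥ x) x] at hnonneg
  have h := mul_le_mul_of_nonneg_left (hCx x) (by positivity : 0 ≤ C⁻¹ * C⁻¹)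
  have hCC : C⁻¹ * C⁻¹ * (C * (x ⬝ᵥ x)) = C⁻¹ * (x ⬝ᵥ x) := by field_simp
  linarith

lemma exists_uniform_dotProduct_mulVec_le {ι : Type*} [Finite ι] [Nonempty ι]
    (Q : ι → Matrix n n ℝ) :
    ∃ C : ℝ, 0 < C ∧ ∀ i, ∀ x : n → ℝ, x ⬝ᵥ (Q i *ᵥ x) ≤ C * (x ⬝ᵥ x) := by
  choose C hC hCx using fun i => exists_dotProduct_mulVec_le (Q i)
  obtain ⟨m, hm⟩ := Finite.exists_max C
  exact ⟨C m, hC m, fun i x => (hCx i x).trans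
    (mul_le_mul_of_nonneg_right (hm i) (Finset.sum_nonneg fun _ _ => mul_self_nonneg _))⟩

lemma exists_uniform_le_dotProduct_mulVec [DecidableEq n] {ι : Type*} [Finite ι] [Nonempty ι]
    {Q : ι → Matrix n n ℝ} (hQ : ∀ i, (Q i).PosDef) :
    ∃ c : ℝ, 0 < c ∧ ∀ i, ∀ x : n → ℝ, c * (x ⬝ᵥ x) ≤ x ⬝ᵥ (Q i *ᵥ x) := by
  choose c hc hcx using fun i => (hQ i).exists_le_dotProduct_mulVec
  obtain ⟨m, hm⟩ := Finite.exists_min c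
  exact ⟨c m, hc m, fun i x => (mul_le_mul_of_nonneg_right (hm i)
    (Finset.sum_nonneg fun _ _ => mul_self_nonneg _)).trans (hcx i x)⟩

/-- Jensen's inequality for a positive semidefinite quadratic form. -/
lemma Matrix.PosSemidef.dotProduct_mulVec_sum_le {Q : Matrix n n ℝ} (hQ : Q.PosSemidef)
    {ι : Type*} [Fintype ι] {w : ι → ℝ} (hw0 : ∀ i, 0 ≤ w i) (hw1 : ∑ i, w i = 1)
    (y : ι → n → ℝ) :
    (∑ i, w i • y i) ⬝ᵥ (Q *ᵥ ∑ i, w i • y i) ≤ ∑ i, w i * (y i ⬝ᵥ (Q *ᵥ y i)) := by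
  set z := ∑ i, w i • y i with hz
  have hsum : ∑ i, w i * (2 * (y i ⬝ᵥ (Q *ᵥ z)) - z ⬝ᵥ (Q *ᵥ z)) = z ⬝ᵥ (Q *ᵥ z) := by
    have h : ∑ i, w i * (y i ⬝ᵥ (Q *ᵥ z)) = z ⬝ᵥ (Q *ᵥ z) := by
      conv_rhs => rw [hz, sum_dotProduct]
      simp only [smul_dotProduct, smul_eq_mul, ← hz]
    simp only [mul_sub, Finset.sum_sub_distrib, ← Finset.sum_mul, hw1, mul_left_comm (w _) 2,
      ← Finset.mul_sum, h]
    ring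
  rw [← hsum]
  refine Finset.sum_le_sum fun i _ => mul_le_mul_of_nonneg_left ?_ (hw0 i)
  have h := hQ.dotProduct_mulVec_nonneg (y i - z)
  simp only [star_trivial, mulVec_sub, sub_dotProduct, dotProduct_sub] at h
  have hsymm : Q.IsSymm := hQ.isHermitian
  linarith [dotProduct_mulVec_comm_of_isSymm hsymm (y i) z]

/-- The Schur complement criterion, in Lyapunov form. -/
lemma posDef_fromBlocks_iff_lyapunov {m : Type*} [Fintype m] [DecidableEq n] [DecidableEq m]
    {S : Matrix n n ℝ} {T : Matrix m m ℝ} (hS : S.PosDef) (hT : T.PosDef) (M : Matrix m n ℝ) :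
    (fromBlocks S (M * S)ᵀ (M * S) T).PosDef ↔
      ∀ x : n → ℝ, x ≠ 0 → (M *ᵥ x) ⬝ᵥ (T⁻¹ *ᵥ (M *ᵥ x)) < x ⬝ᵥ (S⁻¹ *ᵥ x) := by
  have hSdet : IsUnit S.det := (isUnit_iff_isUnit_det S).1 hS.isUnit
  have hTdet : IsUnit T.det := (isUnit_iff_isUnit_det T).1 hT.isUnit
  have hSsymm : S.IsSymm := hS.isHermitian
  have hTsymm : T.IsSymm := hT.isHermitian
  have hTinv : T⁻¹.IsSymm := hT.inv.isHermitian
  have key : ∀ (u : n → ℝ) (v : m → ℝ),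
      Sum.elim u v ⬝ᵥ (fromBlocks S (M * S)ᵀ (M * S) T *ᵥ Sum.elim u v) =
        (S *ᵥ u) ⬝ᵥ (S⁻¹ *ᵥ (S *ᵥ u)) - (M *ᵥ (S *ᵥ u)) ⬝ᵥ (T⁻¹ *ᵥ (M *ᵥ (S *ᵥ u))) +
          (M *ᵥ (S *ᵥ u) + T *ᵥ v) ⬝ᵥ (T⁻¹ *ᵥ (M *ᵥ (S *ᵥ u) + T *ᵥ v)) := by
    intro u v
    have hSu : S⁻¹ *ᵥ (S *ᵥ u) = u := by
      rw [mulVec_mulVec, nonsing_inv_mul _ hSdet, one_mulVec]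
    have hTv : T⁻¹ *ᵥ (T *ᵥ v) = v := by
      rw [mulVec_mulVec, nonsing_inv_mul _ hTdet, one_mulVec]
    have hcross : (T *ᵥ v) ⬝ᵥ (T⁻¹ *ᵥ (M *ᵥ (S *ᵥ u))) = v ⬝ᵥ (M *ᵥ (S *ᵥ u)) := by
      rw [dotProduct_mulVec_comm_of_isSymm hTinv, hTv, dotProduct_comm]
    have htrans : u ⬝ᵥ ((M * S)ᵀ *ᵥ v) = v ⬝ᵥ (M *ᵥ (S *ᵥ u)) := by
      rw [mulVec_transpose, dotProduct_comm, ← dotProduct_mulVec, mulVec_mulVec]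
    rw [fromBlocks_mulVec, sumElim_dotProduct_sumElim]
    simp only [Sum.elim_comp_inl, Sum.elim_comp_inr, dotProduct_add, add_dotProduct, mulVec_add,
      hSu, hTv, hcross, htrans, ← mulVec_mulVec]
    rw [dotProduct_comm (S *ᵥ u) u, dotProduct_comm (T *ᵥ v) v,
      dotProduct_comm (M *ᵥ (S *ᵥ u)) v]
    ring
  constructor
  · intro h x hx
    have hSx : S *ᵥ (S⁻¹ *ᵥ x) = x := by
      rw [mulVec_mulVec, mul_nonsing_inv _ hSdet, one_mulVec]
    have hTx : T *ᵥ (T⁻¹ *ᵥ (M *ᵥ x)) = M *ᵥ x := by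
      rw [mulVec_mulVec, mul_nonsing_inv _ hTdet, one_mulVec]
    have hne : Sum.elim (S⁻¹ *ᵥ x) (-(T⁻¹ *ᵥ (M *ᵥ x))) ≠ 0 := by
      intro h0
      have hu : S⁻¹ *ᵥ x = 0 := funext fun i => congrFun h0 (Sum.inl i)
      exact hx (by rw [← hSx, hu, mulVec_zero])
    have hpos := h.dotProduct_mulVec_pos hne
    rw [star_trivial, key, hSx, mulVec_neg, hTx, add_neg_cancel, zero_dotProduct] at hpos
    linarith
  · intro h
    refine PosDef.of_dotProduct_mulVec_pos ?_ fun z hz => ?_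
    · exact isHermitian_fromBlocks_iff.2
        ⟨hS.isHermitian, by simp [conjTranspose_eq_transpose_of_trivial],
          by simp [conjTranspose_eq_transpose_of_trivial], hT.isHermitian⟩
    · obtain ⟨u, v, rfl⟩ : ∃ u v, z = Sum.elim u v :=
        ⟨z ∘ Sum.inl, z ∘ Sum.inr, (Sum.elim_comp_inl_inr z).symm⟩
      rw [star_trivial, key]
      have hlast := hT.inv.posSemidef.dotProduct_mulVec_nonneg (M *ᵥ (S *ᵥ u) + T *ᵥ v)
      rw [star_trivial] at hlast
      by_cases hu : u = 0
      · subst hu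
        have hv : v ≠ 0 := by
          rintro rfl
          exact hz (by ext (i | i) <;> rfl)
        have hTv : T⁻¹ *ᵥ (T *ᵥ v) = v := by
          rw [mulVec_mulVec, nonsing_inv_mul _ hTdet, one_mulVec]
        have hpos := hT.dotProduct_mulVec_pos hv
        rw [star_trivial] at hpos
        simpa [hTv, dotProduct_comm (T *ᵥ v) v] using hpos
      · have hSu : S *ᵥ u ≠ 0 := by
          intro h0
          apply hu
          rw [← one_mulVec u, ← nonsing_inv_mul _ hSdet, ← mulVec_mulVec, h0, mulVec_zero]
        linarith [h _ hSu]

end QuadraticForm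

/-- Theorem 4 (T4.2 ⇔ T4.3) for strictly polytopic systems: existence of a
polytopic poly-quadratically stabilizing state-feedback gain is equivalent to
feasibility of the synthesis LMIs. -/
theorem polytopic_gain_iff_synthesis_lmi (nx nu np N : ℕ)
    (hnx : 0 < nx) (hnu : 0 < nu) (hnp : 0 < np) (hN : 0 < N)
    (Pset : Set (Fin np → ℝ)) (hPc : IsCompact Pset)
    (ξ : Fin N → Pset → ℝ)
    (hξc : ∀ i, Continuous (ξ i))
    (hξ0 : ∀ i π, 0 ≤ ξ i π)
    (hξ1 : ∀ π, ∑ i, ξ i π = 1)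
    (hstrict : ∀ i : Fin N, ∃ π : Pset, ∀ j, ξ j π = if j = i then 1 else 0)
    (A : Fin N → Matrix (Fin nx) (Fin nx) ℝ)
    (B : Matrix (Fin nx) (Fin nu) ℝ) :
    (∃ Kbar : Fin N → Matrix (Fin nu) (Fin nx) ℝ,
      ∃ Pb : Fin N → Matrix (Fin nx) (Fin nx) ℝ,
        (∀ i, (Pb i).IsSymm) ∧
        RendersClosedLoopPolyQS nx nu np N Pset ξ A B
          (fun k p => ∑ i, ξ i (p k) • Kbar i) Pb) ↔
    (∃ (S : Fin N → Matrix (Fin nx) (Fin nx) ℝ)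
       (Y : Fin N → Matrix (Fin nu) (Fin nx) ℝ),
      (∀ i, (S i).PosDef) ∧
      ∀ i j, (fromBlocks (S i) ((A i * S i + B * Y i)ᵀ)
          (A i * S i + B * Y i) (S j)).PosDef) := by
  have : Nonempty (Fin N) := ⟨⟨0, hN⟩⟩
  have hclosed : ∀ (K : Fin N → Matrix (Fin nu) (Fin nx) ℝ) (π : Pset) (x : Fin nx → ℝ),
      ((∑ i, ξ i π • A i) + B * ∑ i, ξ i π • K i) *ᵥ x =
        ∑ i, ξ i π • ((A i + B * K i) *ᵥ x) := by
    intro K π x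
    simp only [Matrix.mul_sum, Matrix.mul_smul, ← Finset.sum_add_distrib, ← smul_add,
      sum_mulVec, smul_mulVec]
  constructor
  · rintro ⟨K, P, hPsymm, a₁, a₂, a₃, ha₁, ha₂, ha₃, hbound, hdec⟩
    choose v hv using hstrict
    have hvertex : ∀ {E : Type} [AddCommGroup E] [Module ℝ E] (i : Fin N) (F : Fin N → E),
        ∑ j, ξ j (v i) • F j = F i := by
      intro E _ _ i F
      simp [hv]
    have hpos : ∀ x : Fin nx → ℝ, x ≠ 0 → 0 < x ⬝ᵥ x := fun x hx => by
      simpa using dotProduct_star_self_pos_iff.2 hx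
    have hP : ∀ i, (P i).PosDef := fun i =>
      PosDef.of_dotProduct_mulVec_pos (hPsymm i) fun x hx => by
        have h := (hbound (v i) x).1
        rw [hvertex] at h
        rw [star_trivial]
        exact (mul_pos ha₁ (hpos x hx)).trans_le h
    have hPdet : ∀ i, IsUnit (P i).det := fun i => (isUnit_iff_isUnit_det _).1 (hP i).isUnit
    refine ⟨fun i => (P i)⁻¹, fun i => K i * (P i)⁻¹, fun i => (hP i).inv, fun i j => ?_⟩
    rw [← Matrix.mul_assoc, ← Matrix.add_mul,
      posDef_fromBlocks_iff_lyapunov (hP i).inv (hP j).inv,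
      nonsing_inv_nonsing_inv _ (hPdet i), nonsing_inv_nonsing_inv _ (hPdet j)]
    intro x hx
    have h := hdec (fun k => if k = 0 then v i else v j) 0 x
    simp only [zero_add, one_ne_zero, if_true, if_false, hvertex] at h
    linarith [mul_pos ha₃ (hpos x hx)]
  · rintro ⟨S, Y, hS, hLMI⟩
    have hSdet : ∀ i, IsUnit (S i).det := fun i => (isUnit_iff_isUnit_det _).1 (hS i).isUnit
    have hP : ∀ i, (S i)⁻¹.PosDef := fun i => (hS i).inv
    set M : Fin N → Matrix (Fin nx) (Fin nx) ℝ := fun i => A i + B * (Y i * (S i)⁻¹) with hM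
    have hMS : ∀ i, A i * S i + B * Y i = M i * S i := fun i => by
      rw [hM, Matrix.add_mul, Matrix.mul_assoc B, nonsing_inv_mul_cancel_right _ _ (hSdet i)]
    have hform : ∀ (i j : Fin N) (x : Fin nx → ℝ),
        x ⬝ᵥ (((S i)⁻¹ - (M i)ᵀ * (S j)⁻¹ * M i) *ᵥ x) =
          x ⬝ᵥ ((S i)⁻¹ *ᵥ x) - (M i *ᵥ x) ⬝ᵥ ((S j)⁻¹ *ᵥ (M i *ᵥ x)) := by
      intro i j x
      rw [sub_mulVec, dotProduct_sub, ← mulVec_mulVec, ← mulVec_mulVec, mulVec_transpose,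
        dotProduct_comm x (_ ᵥ* _), ← dotProduct_mulVec, dotProduct_comm (_ *ᵥ _) (M i *ᵥ x)]
    have hdiff : ∀ q : Fin N × Fin N,
        ((S q.1)⁻¹ - (M q.1)ᵀ * (S q.2)⁻¹ * M q.1).PosDef := by
      rintro ⟨i, j⟩
      refine PosDef.of_dotProduct_mulVec_pos
        ((hP i).isHermitian.sub (isHermitian_conjTranspose_mul_mul (M i) (hP j).isHermitian))
        fun x hx => ?_
      have h := hLMI i j
      rw [hMS, posDef_fromBlocks_iff_lyapunov (hS i) (hS j)] at h
      rw [star_trivial, hform]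
      exact sub_pos.2 (h x hx)
    obtain ⟨a₁, ha₁, hlow⟩ := exists_uniform_le_dotProduct_mulVec hP
    obtain ⟨a₂, ha₂, hupp⟩ := exists_uniform_dotProduct_mulVec_le fun i => (S i)⁻¹
    obtain ⟨a₃, ha₃, hdec⟩ := exists_uniform_le_dotProduct_mulVec hdiff
    have hconst : ∀ (π : Pset) (c : ℝ), ∑ i, ξ i π * c = c := fun π c => by
      rw [← Finset.sum_mul, hξ1, one_mul]
    refine ⟨fun i => Y i * (S i)⁻¹, fun i => (S i)⁻¹, fun i => (hP i).isHermitian,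
      a₁, a₂, a₃, ha₁, ha₂, ha₃, fun π x => ?_, fun p k x => ?_⟩
    · rw [dotProduct_sum_smul_mulVec]
      constructor
      · rw [← hconst π (a₁ * _)]
        exact Finset.sum_le_sum fun i _ => mul_le_mul_of_nonneg_left (hlow i x) (hξ0 i π)
      · rw [← hconst π (a₂ * _)]
        exact Finset.sum_le_sum fun i _ => mul_le_mul_of_nonneg_left (hupp i x) (hξ0 i π)
    · have hQ : (∑ j, ξ j (p (k + 1)) • (S j)⁻¹).PosSemidef :=
        posSemidef_sum _ fun j _ => (hP j).posSemidef.smul (hξ0 j _)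
      simp only [hclosed]
      refine (hQ.dotProduct_mulVec_sum_le (fun i => hξ0 i (p k)) (hξ1 (p k)) _).trans ?_
      rw [dotProduct_sum_smul_mulVec, ← hconst (p k) (a₃ * _), ← Finset.sum_sub_distrib]
      refine Finset.sum_le_sum fun i _ => ?_
      rw [← mul_sub]
      refine mul_le_mul_of_nonneg_left ?_ (hξ0 i _)
      rw [dotProduct_sum_smul_mulVec, ← hconst (p (k + 1)) (_ - _)]
      refine Finset.sum_le_sum fun j _ => mul_le_mul_of_nonneg_left ?_ (hξ0 j _)
      have h := hdec (i, j) x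
      rw [hform] at h
      linarith
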